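/- Let p be a prime, let m, n ≥ 1 be integers, and let H be a finite abelian p-group with D(H) ≤ pⁿ. Let G = C_{m·pⁿ} ⊕ H. Then any zero-sum sequence over G of length at least D(G) + 1 contains a nonempty zero-sum subsequence of length at most exp(G). -/

import Mathlib

/-- The zero-sum invariant `s_L(G)`: the smallest positive integer `ℓ` such that every
sequence (multiset) over `G` of length at least `ℓ` contains a nonempty zero-sum
subsequence whose length lies in `L`. -/
noncomputable def zsInv (G : Type*) [AddCommGroup G] (L : Set ℕ) : ℕ :=
  sInf {ℓ : ℕ | 0 < ℓ ∧ ∀ S : Multiset G, ℓ ≤ Multiset.card S →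
    ∃ T : Multiset G, T ≤ S ∧ T ≠ 0 ∧ T.sum = 0 ∧ Multiset.card T ∈ L}

/-- The Davenport constant `D(G)`. -/
noncomputable def davenport (G : Type*) [AddCommGroup G] : ℕ := zsInv G {t | 0 < t}

/-- The η-invariant `η(G) = s_{[1, exp(G)]}(G)`. -/
noncomputable def etaInv (G : Type*) [AddCommGroup G] : ℕ :=
  zsInv G {t | 0 < t ∧ t ≤ AddMonoid.exponent G}

/-- The Erdős–Ginzburg–Ziv constant `s(G) = s_{{exp(G)}}(G)`. -/
noncomputable def egzConst (G : Type*) [AddCommGroup G] : ℕ :=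
  zsInv G {AddMonoid.exponent G}

/-- `η_i(G) = s_{[i, exp(G)]}(G)`. -/
noncomputable def etaI (G : Type*) [AddCommGroup G] (i : ℕ) : ℕ :=
  zsInv G {t | i ≤ t ∧ t ≤ AddMonoid.exponent G}

/-- `ζ_i(G) = s_{[i-n,0] + nℕ⁺}(G)` where `n = exp(G)`: the invariant for zero-sum
subsequences whose length is congruent mod `n` to some residue `r` with `i ≤ r ≤ n`. -/
noncomputable def zetaI (G : Type*) [AddCommGroup G] (i : ℕ) : ℕ :=
  zsInv G {t | 0 < t ∧ ∃ r : ℕ, i ≤ r ∧ r ≤ AddMonoid.exponent G ∧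
    t % AddMonoid.exponent G = r % AddMonoid.exponent G}

/-- Every multiset over `A` with at least `k` elements has a nonempty zero-sum submultiset. -/
def ForcesZeroSum (A : Type*) [AddCommGroup A] (k : ℕ) : Prop :=
  ∀ S : Multiset A, k ≤ Multiset.card S → ∃ T : Multiset A, T ≤ S ∧ T ≠ 0 ∧ T.sum = 0

/-- The multiset `S` has no nonempty zero-sum submultiset. -/
def ZeroSumFree {A : Type*} [AddCommGroup A] (S : Multiset A) : Prop :=
  ∀ T ≤ S, T.sum = 0 → T = 0

section Multisets

theorem Multiset.exists_le_map_eq_of_le_map {α β : Type*} {f : α → β} {S : Multiset α}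
    {T : Multiset β} (h : T ≤ S.map f) : ∃ U ≤ S, U.map f = T := by
  induction S using Quotient.inductionOn with
  | _ l =>
    induction T using Quotient.inductionOn with
    | _ t =>
      obtain ⟨u, hut, hul⟩ := Multiset.coe_le.1 (by simpa using h : (t : Multiset β) ≤ (l.map f : List β))
      obtain ⟨v, hv, rfl⟩ := List.sublist_map_iff.1 hul
      exact ⟨v, Multiset.coe_le.2 hv.subperm, by simpa using hut⟩

theorem Multiset.exists_le_card_eq_of_le {α : Type*} {S : Multiset α} {k : ℕ}
    (h : k ≤ Multiset.card S) : ∃ T ≤ S, Multiset.card T = k := by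
  induction S using Quotient.inductionOn with
  | _ l => exact ⟨(l.take k : List α), Multiset.coe_le.2 (List.take_sublist k l).subperm, by
      simpa using h⟩

end Multisets

section Davenport

variable {A : Type*} [AddCommGroup A]

/-- A finite group forces zero sums in every multiset of cardinality at least its order. -/
theorem forcesZeroSum_card [Finite A] : ForcesZeroSum A (Nat.card A) := by
  intro S hS
  induction S using Quotient.inductionOn with
  | _ l =>
    have hlen : Nat.card A ≤ l.length := by simpa using hS
    have key : ∃ i j : Fin (l.length + 1), i < j ∧ (l.take i).sum = (l.take j).sum := by
      have := Fintype.ofFinite A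
      obtain ⟨i, j, hij, h⟩ := Fintype.exists_ne_map_eq_of_card_lt
        (fun i : Fin (l.length + 1) => (l.take i).sum)
        (by rw [← Nat.card_eq_fintype_card, Fintype.card_fin]; omega)
      rcases lt_or_gt_of_ne hij with h' | h'
      · exact ⟨i, j, h', h⟩
      · exact ⟨j, i, h', h.symm⟩
    obtain ⟨i, j, hij, h⟩ := key
    have hij' : (i : ℕ) < j := hij
    have hj : (j : ℕ) ≤ l.length := Nat.lt_succ_iff.1 j.2
    refine ⟨((l.take j).drop i : List A), Multiset.coe_le.2
      ((List.drop_sublist _ _).trans (List.take_sublist _ _)).subperm, ?_, ?_⟩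
    · intro h0
      have := congrArg Multiset.card h0
      simp at this
      omega
    · have h1 := List.sum_take_add_sum_drop (l.take j) i
      rw [List.take_take, min_eq_left hij'.le, h] at h1
      simpa using h1

theorem lt_davenport_of_zeroSumFree [Finite A] {S : Multiset A} (hS : ZeroSumFree S) :
    Multiset.card S < davenport A := by
  have hne : {ℓ : ℕ | 0 < ℓ ∧ ∀ S : Multiset A, ℓ ≤ Multiset.card S →
      ∃ T : Multiset A, T ≤ S ∧ T ≠ 0 ∧ T.sum = 0 ∧ Multiset.card T ∈ {t | 0 < t}}.Nonempty := by
    refine ⟨Nat.card A, Nat.card_pos, fun S hS => ?_⟩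
    obtain ⟨T, h1, h2, h3⟩ := forcesZeroSum_card S hS
    exact ⟨T, h1, h2, h3, Multiset.card_pos.2 h2⟩
  by_contra! hlt
  obtain ⟨T, h1, h2, h3, -⟩ := (Nat.sInf_mem hne).2 S hlt
  exact h2 (hS T h1 h3)

/-- A zero-sum free multiset in the kernel of a map to `ZMod k` can be extended by `k - 1`
copies of an element mapped to `1`. -/
theorem ZeroSumFree.add_replicate {k : ℕ} (hk : 0 < k) (φ : A →+ ZMod k) {a : A} (ha : φ a = 1)
    {S : Multiset A} (hS : ZeroSumFree S) (hφ : ∀ s ∈ S, φ s = 0) :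
    ZeroSumFree (S + Multiset.replicate (k - 1) a) := by
  classical
  intro T hT h0
  set R := Multiset.replicate (k - 1) a
  have hsplit : T ∩ S + (T - S) = T := by
    rw [add_comm, Multiset.sub_add_inter]
  have hR : T - S ≤ R := by
    rwa [tsub_le_iff_left]
  obtain ⟨j, hj, hTj⟩ := Multiset.le_replicate_iff.1 hR
  have hφS : φ (T ∩ S).sum = 0 := by
    rw [map_multiset_sum]
    refine Multiset.sum_eq_zero fun x hx => ?_
    obtain ⟨s, hs, rfl⟩ := Multiset.mem_map.1 hx
    exact hφ s (Multiset.mem_of_le Multiset.inter_le_right hs)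
  have hj0 : (j : ZMod k) = 0 := by
    have := congrArg φ h0
    rw [← hsplit, hTj, Multiset.sum_add, map_add, hφS] at this
    simpa [ha] using this
  have hj1 : j = 0 := Nat.eq_zero_of_dvd_of_lt ((ZMod.natCast_eq_zero_iff _ _).1 hj0) (by omega)
  have hTS : T - S = 0 := by rw [hTj, hj1, Multiset.replicate_zero]
  exact hS T (by simpa [hTS] using tsub_le_iff_left.1 hTS.le) h0

theorem ZeroSumFree.sum_replicate {ι : Type*} [DecidableEq ι] (k : ι → ℕ) (hk : ∀ i, 0 < k i)
    (φ : ∀ i, A →+ ZMod (k i)) (a : ι → A) (h1 : ∀ i, φ i (a i) = 1)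
    (h0 : ∀ i j, i ≠ j → φ i (a j) = 0) (s : Finset ι) :
    ZeroSumFree (∑ i ∈ s, Multiset.replicate (k i - 1) (a i)) := by
  induction s using Finset.induction_on with
  | empty => exact fun T hT _ => by simpa using hT
  | insert i s hi ih =>
    rw [Finset.sum_insert hi, add_comm]
    refine ih.add_replicate (hk i) (φ i) (h1 i) fun x hx => ?_
    obtain ⟨j, hj, hxj⟩ := Multiset.mem_sum.1 hx
    rw [Multiset.eq_of_mem_replicate hxj]
    exact h0 i j (by rintro rfl; exact hi hj)

end Davenport

section Olson

variable {A : Type*} [AddCommGroup A]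

open AddMonoidAlgebra in
theorem prod_one_sub_single_sub_one_mem_span (R : Type*) [CommRing R] (S : Multiset A) :
    (S.map fun a => (1 - single a 1 : AddMonoidAlgebra R A)).prod - 1 ∈
      Submodule.span R {x | ∃ T ≤ S, T ≠ 0 ∧ x = single T.sum (1 : R)} := by
  induction S using Multiset.induction_on with
  | empty => simp
  | cons a S ih =>
    rw [Multiset.map_cons, Multiset.prod_cons]
    set y := (S.map fun a => (1 - single a 1 : AddMonoidAlgebra R A)).prod
    set M := Submodule.span R {x : AddMonoidAlgebra R A |
      ∃ T ≤ a ::ₘ S, T ≠ 0 ∧ x = single T.sum (1 : R)}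
    have h1 : y - 1 ∈ M := by
      refine Submodule.span_mono ?_ ih
      rintro x ⟨T, hT, h⟩
      exact ⟨T, hT.trans (Multiset.le_cons_self _ _), h⟩
    have h2 : (single a 1 : AddMonoidAlgebra R A) ∈ M :=
      Submodule.subset_span ⟨{a}, by simp, by simp, by simp⟩
    have h3 : single a 1 * (y - 1) ∈ M := by
      have hle : Submodule.span R {x | ∃ T ≤ S, T ≠ 0 ∧ x = single T.sum (1 : R)} ≤
          M.comap (LinearMap.mulLeft R (single a 1 : AddMonoidAlgebra R A)) := by
        rw [Submodule.span_le]
        rintro x ⟨T, hT, -, rfl⟩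
        refine Submodule.subset_span ⟨a ::ₘ T, Multiset.cons_le_cons _ hT, by simp, ?_⟩
        simp [single_mul_single]
      exact hle ih
    have : (1 - single a 1) * y - 1 = (y - 1) - single a 1 - single a 1 * (y - 1) := by ring
    rw [this]
    exact M.sub_mem (M.sub_mem h1 h2) h3

/-- If a product of elements `1 - X ^ a` vanishes in a nontrivial group algebra, the `a` have a
nonempty zero-sum submultiset. -/
theorem exists_zeroSum_of_prod_eq_zero (R : Type*) [CommRing R] [Nontrivial R] (S : Multiset A)
    (h : (S.map fun a => (1 - AddMonoidAlgebra.single a 1 : AddMonoidAlgebra R A)).prod = 0) :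
    ∃ T : Multiset A, T ≤ S ∧ T ≠ 0 ∧ T.sum = 0 := by
  by_contra! hS
  have hmem := prod_one_sub_single_sub_one_mem_span R S
  rw [h, zero_sub] at hmem
  have hcoeff : ∀ x ∈ Submodule.span R {x : AddMonoidAlgebra R A |
      ∃ T ≤ S, T ≠ 0 ∧ x = AddMonoidAlgebra.single T.sum (1 : R)}, x.coeff 0 = 0 := by
    intro x hx
    induction hx using Submodule.span_induction with
    | mem x hx =>
      obtain ⟨T, hT, hT0, rfl⟩ := hx
      simp [AddMonoidAlgebra.coeff_single, hS T hT hT0]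
    | zero => simp
    | add x y _ _ hx hy => simp [hx, hy]
    | smul r x _ hx => simp [hx]
  have := hcoeff _ hmem
  simp [AddMonoidAlgebra.one_def] at this

theorem sum_pow_eq_zero_of_pow_eq_zero {Q ι : Type*} [CommSemiring Q] (x : ι → Q) (n : ι → ℕ)
    (s : Finset ι) (h : ∀ i ∈ s, x i ^ (n i + 1) = 0) :
    (∑ i ∈ s, x i) ^ (∑ i ∈ s, n i + 1) = 0 := by
  classical
  induction s using Finset.induction_on with
  | empty => simp
  | insert i s hi ih =>
    rw [Finset.sum_insert hi, Finset.sum_insert hi]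
    refine (Commute.all _ _).add_pow_eq_zero_of_add_le_succ_of_pow_eq_zero
      (h i (Finset.mem_insert_self _ _)) (ih fun j hj => h j (Finset.mem_insert_of_mem hj)) ?_
    omega

/-- Olson's upper bound for the Davenport constant of a finite abelian `p`-group. -/
theorem forcesZeroSum_of_generators {p : ℕ} (hp : p.Prime) {ι : Type*} [Fintype ι] (a : ι → A)
    (e : ι → ℕ) (ha : ∀ i, p ^ e i • a i = 0) (hgen : AddSubgroup.closure (Set.range a) = ⊤) :
    ForcesZeroSum A (∑ i, (p ^ e i - 1) + 1) := by
  have : Fact p.Prime := ⟨hp⟩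
  have : CharP (AddMonoidAlgebra (ZMod p) A) p :=
    charP_of_injective_algebraMap (algebraMap (ZMod p) (AddMonoidAlgebra (ZMod p) A)).injective p
  let X : A → AddMonoidAlgebra (ZMod p) A := fun b => AddMonoidAlgebra.single b 1
  have hXadd : ∀ b c, X (b + c) = X b * X c := fun b c => by
    simp [X, AddMonoidAlgebra.single_mul_single]
  have hX0 : X 0 = 1 := rfl
  let I : Ideal (AddMonoidAlgebra (ZMod p) A) := ∑ i, Ideal.span {1 - X (a i)}
  have hI : I ^ (∑ i, (p ^ e i - 1) + 1) = 0 := by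
    refine sum_pow_eq_zero_of_pow_eq_zero _ _ _ fun i _ => ?_
    rw [Nat.sub_add_cancel (Nat.one_le_pow _ _ hp.pos), Ideal.span_singleton_pow,
      sub_pow_char_pow, one_pow, AddMonoidAlgebra.single_pow, ha, one_pow]
    simp [AddMonoidAlgebra.one_def]
  have hmem : ∀ b, 1 - X b ∈ I := by
    intro b
    have hb : b ∈ AddSubgroup.closure (Set.range a) := hgen ▸ AddSubgroup.mem_top b
    induction hb using AddSubgroup.closure_induction with
    | mem x hx =>
      obtain ⟨i, rfl⟩ := hx
      have hle : Ideal.span {1 - X (a i)} ≤ I :=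
        Finset.single_le_sum (f := fun i => Ideal.span {1 - X (a i)})
          (fun _ _ => bot_le) (Finset.mem_univ i)
      exact hle (Ideal.mem_span_singleton_self _)
    | zero => simp [hX0]
    | add x y _ _ hx hy =>
      rw [hXadd, show 1 - X x * X y = (1 - X x) + X x * (1 - X y) by ring]
      exact I.add_mem hx (I.mul_mem_left _ hy)
    | neg x _ hx =>
      have h1 : X (-x) * X x = 1 := by rw [← hXadd, neg_add_cancel, hX0]
      rw [show 1 - X (-x) = -X (-x) * (1 - X x) by linear_combination -h1]
      exact I.mul_mem_left _ hx
  intro S hS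
  refine exists_zeroSum_of_prod_eq_zero (ZMod p) S ?_
  have hprod : (S.map fun b => 1 - X b).prod ∈ I ^ Multiset.card S := by
    clear hS
    induction S using Multiset.induction_on with
    | empty => simp
    | cons b S ih =>
      rw [Multiset.map_cons, Multiset.prod_cons, Multiset.card_cons, pow_succ']
      exact Ideal.mul_mem_mul (hmem b) ih
  have := Ideal.pow_le_pow_right hS hprod
  rw [hI] at this
  exact this

end Olson

section Structure

/-- A finite abelian `p`-group has independent generators of prime power orders, together with
the corresponding coordinate maps. -/
theorem exists_generators_and_coordinates {p : ℕ} (hp : p.Prime) (H : Type*) [AddCommGroup H]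
    [Finite H] (hpH : ∀ h : H, ∃ k : ℕ, p ^ k • h = 0) :
    ∃ (ι : Type) (_ : Fintype ι) (e : ι → ℕ) (a : ι → H) (φ : ∀ i, H →+ ZMod (p ^ e i)),
      (∀ i, φ i (a i) = 1) ∧ (∀ i j, i ≠ j → φ i (a j) = 0) ∧ (∀ i, p ^ e i • a i = 0) ∧
      AddSubgroup.closure (Set.range a) = ⊤ := by
  classical
  obtain ⟨ι, _, r, -, l, ⟨g₀⟩⟩ := AddCommGroup.equiv_directSum_zmod_of_finite H
  let g' := g₀.trans (DirectSum.addEquivProd _)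
  have hpow : ∀ i, ∃ e, r i ^ l i = p ^ e := by
    intro i
    obtain ⟨k, hk⟩ := hpH (g'.symm (Pi.single i 1))
    have h1 := congrArg (fun x => g' x i) hk
    simp only [map_nsmul, AddEquiv.apply_symm_apply, Pi.smul_apply, Pi.single_eq_same, map_zero,
      Pi.zero_apply, nsmul_eq_mul, mul_one] at h1
    obtain ⟨e, -, he⟩ := (Nat.dvd_prime_pow hp).1 ((ZMod.natCast_eq_zero_iff _ _).1 h1)
    exact ⟨e, he⟩
  choose e he using hpow
  let g : H ≃+ ∀ i, ZMod (p ^ e i) :=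
    g'.trans (AddEquiv.piCongrRight fun i => (ZMod.ringEquivCongr (he i)).toAddEquiv)
  refine ⟨ι, inferInstance, e, fun i => g.symm (Pi.single i 1),
    fun i => (Pi.evalAddMonoidHom _ i).comp g.toAddMonoidHom, ?_, ?_, ?_, ?_⟩
  · intro i; simp
  · intro i j hij; simp [hij]
  · intro i
    rw [← map_nsmul, ← Pi.single_smul, nsmul_eq_mul, mul_one, ZMod.natCast_self]
    simp
  · rw [eq_top_iff]
    intro x _
    have hx : x = ∑ i, (g x i).val • g.symm (Pi.single i 1) := by
      apply g.injective
      rw [map_sum]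
      simp only [map_nsmul, AddEquiv.apply_symm_apply]
      conv_lhs => rw [← Finset.univ_sum_single (g x)]
      refine Finset.sum_congr rfl fun i _ => ?_
      have : NeZero (p ^ e i) := ⟨pow_ne_zero _ hp.ne_zero⟩
      rw [← Pi.single_smul, nsmul_eq_mul, mul_one, ZMod.natCast_zmod_val]
    rw [hx]
    exact AddSubgroup.sum_mem _ fun i _ =>
      AddSubgroup.nsmul_mem _ (AddSubgroup.subset_closure (Set.mem_range_self i)) _

end Structure

section ShortZeroSums

variable {A : Type*} [AddCommGroup A]

/-- A zero-sum multiset with a proper nonempty zero-sum submultiset has one with at most half of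
its elements. -/
theorem exists_zeroSum_card_le_of_card_le_add {q : ℕ} {S T : Multiset A} (hS : S.sum = 0)
    (hTS : T ≤ S) (hT0 : T ≠ 0) (hT : T.sum = 0) (hlt : Multiset.card T < Multiset.card S)
    (h : Multiset.card T ≤ q ∨ Multiset.card S ≤ Multiset.card T + q) :
    ∃ T ≤ S, T ≠ 0 ∧ T.sum = 0 ∧ Multiset.card T ≤ q := by
  classical
  rcases h with h | h
  · exact ⟨T, hTS, hT0, hT, h⟩
  · have hc := Multiset.card_sub hTS
    refine ⟨S - T, tsub_le_self, ?_, ?_, by omega⟩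
    · rw [← Multiset.card_pos]; omega
    · have := congrArg Multiset.sum (tsub_add_cancel_of_le hTS)
      rwa [Multiset.sum_add, hT, add_zero, hS] at this

theorem Multiset.exists_le_le_add_eq_of_le_add {α : Type*} {S U V : Multiset α} (h : S ≤ U + V) :
    ∃ X ≤ U, ∃ Y ≤ V, X + Y = S := by
  classical
  exact ⟨S ∩ U, Multiset.inter_le_right, S - U, tsub_le_iff_left.2 h, by
    rw [add_comm, Multiset.sub_add_inter]⟩

theorem exists_zeroSum_card_le_of_card_le_two_mul {q d : ℕ} (h1 : ForcesZeroSum A (q + d))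
    {S : Multiset A} (hS : S.sum = 0) (hcard : q + d < Multiset.card S)
    (hcard' : Multiset.card S ≤ 2 * q) :
    ∃ T ≤ S, T ≠ 0 ∧ T.sum = 0 ∧ Multiset.card T ≤ q := by
  obtain ⟨S', hS', hc⟩ := Multiset.exists_le_card_eq_of_le hcard.le
  obtain ⟨T, hT, hT0, hTs⟩ := h1 S' hc.ge
  have := Multiset.card_le_card hT
  exact exists_zeroSum_card_le_of_card_le_add hS (hT.trans hS') hT0 hTs (by omega) (by omega)

/-- Short zero-sum submultisets of zero-sum multisets, from the Davenport constants of `A` and of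
`C_q ⊕ A`. -/
theorem exists_zeroSum_card_le {q d : ℕ} (hd : d < q) (h1 : ForcesZeroSum A (q + d))
    (h2 : ForcesZeroSum (ZMod q × A) (3 * q - 1))
    {S : Multiset A} (hS : S.sum = 0) (hcard : q + d < Multiset.card S) :
    ∃ T ≤ S, T ≠ 0 ∧ T.sum = 0 ∧ Multiset.card T ≤ q := by
  by_cases hA : Multiset.card S ≤ 2 * q
  · exact exists_zeroSum_card_le_of_card_le_two_mul h1 hS hcard hA
  have hsum : ∀ U : Multiset A, (U.map fun x => ((1 : ZMod q), x)).sum =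
      ((Multiset.card U : ZMod q), U.sum) := by
    intro U
    induction U using Multiset.induction_on with
    | empty => simp [Prod.ext_iff]
    | cons a U ih => simp [ih, add_comm]
  by_cases hB : Multiset.card S < 3 * q
  · obtain ⟨T, hT, hT0, hTs⟩ := h2 (S.map (fun x => ((1 : ZMod q), x)) +
      Multiset.replicate (3 * q - 1 - Multiset.card S) ((1 : ZMod q), (0 : A)))
      (by simp; omega)
    obtain ⟨X, hX, Y, hY, rfl⟩ := Multiset.exists_le_le_add_eq_of_le_add hT
    obtain ⟨U, hU, rfl⟩ := Multiset.exists_le_map_eq_of_le_map hX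
    obtain ⟨j, hj, rfl⟩ := Multiset.le_replicate_iff.1 hY
    rw [Multiset.sum_add, hsum, Multiset.sum_replicate, Prod.ext_iff] at hTs
    obtain ⟨hs1, hs2⟩ := hTs
    simp only [Prod.fst_add, Prod.smul_fst, Prod.snd_add, Prod.smul_snd, Prod.fst_zero,
      Prod.snd_zero, smul_zero, add_zero, nsmul_eq_mul, mul_one] at hs1 hs2
    obtain ⟨c, hc⟩ : q ∣ Multiset.card U + j :=
      (ZMod.natCast_eq_zero_iff _ _).1 (by push_cast; exact hs1)
    have hUc := Multiset.card_le_card hU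
    have hpos : 0 < Multiset.card U + j := by
      simpa using Multiset.card_pos.2 hT0
    have hc1 : 0 < c := by
      rcases Nat.eq_zero_or_pos c with rfl | h
      · omega
      · exact h
    have hc3 : c < 3 := by
      by_contra! h
      have := Nat.mul_le_mul_left q h
      omega
    refine exists_zeroSum_card_le_of_card_le_add hS hU ?_ hs2 ?_ ?_
    · rw [← Multiset.card_pos]
      interval_cases c <;> omega
    · interval_cases c <;> omega
    · interval_cases c <;> omega
  · obtain ⟨S', hS', hc'⟩ := Multiset.exists_le_card_eq_of_le
      (show 3 * q - 1 ≤ Multiset.card S by omega)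
    obtain ⟨T, hT, hT0, hTs⟩ := h2 (S'.map (fun x => ((1 : ZMod q), x))) (by simp [hc'])
    obtain ⟨U, hU, rfl⟩ := Multiset.exists_le_map_eq_of_le_map hT
    rw [hsum, Prod.ext_iff] at hTs
    obtain ⟨hs1, hs2⟩ := hTs
    obtain ⟨c, hc⟩ := (ZMod.natCast_eq_zero_iff _ _).1 hs1
    have hUc := Multiset.card_le_card hU
    have hc3 : c < 3 := by
      by_contra! h
      have := Nat.mul_le_mul_left q h
      omega
    have hU0 : U ≠ 0 := by simpa using hT0
    by_cases hUq : Multiset.card U ≤ q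
    · exact ⟨U, hU.trans hS', hU0, hs2, hUq⟩
    · obtain ⟨T, h3, h4⟩ := exists_zeroSum_card_le_of_card_le_two_mul (S := U) h1 hs2
        (by interval_cases c <;> omega) (by interval_cases c <;> omega)
      exact ⟨T, h3.trans (hU.trans hS'), h4⟩

/-- Splitting off `k` disjoint short blocks with sums in the kernel of `f`. -/
theorem exists_blocks {G : Type*} [AddCommGroup G] (f : G →+ A) {q c : ℕ}
    (hshort : ∀ S : Multiset A, S.sum = 0 → q + c ≤ Multiset.card S →
      ∃ T ≤ S, T ≠ 0 ∧ T.sum = 0 ∧ Multiset.card T ≤ q) (k : ℕ) :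
    ∀ S : Multiset G, f S.sum = 0 → k * q + c ≤ Multiset.card S →
      ∃ B : Multiset (Multiset G), Multiset.card B = k ∧ B.sum ≤ S ∧
        ∀ T ∈ B, T ≠ 0 ∧ f T.sum = 0 ∧ Multiset.card T ≤ q := by
  classical
  induction k with
  | zero => exact fun S _ _ => ⟨0, by simp⟩
  | succ k ih =>
    intro S hS hcard
    rw [Nat.succ_mul] at hcard
    obtain ⟨T', hT', hT0, hTs, hTc⟩ := hshort (S.map f) (by rw [← map_multiset_sum, hS])
      (by rw [Multiset.card_map]; exact le_trans (by omega) hcard)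
    obtain ⟨T, hT, rfl⟩ := Multiset.exists_le_map_eq_of_le_map hT'
    rw [← map_multiset_sum] at hTs
    rw [Multiset.card_map] at hTc
    have hsplit := tsub_add_cancel_of_le hT
    obtain ⟨B, hB, hBS, hBT⟩ := ih (S - T) (by
      have := congrArg (fun U => f (Multiset.sum U)) hsplit
      simpa [hTs, hS] using this) (by rw [Multiset.card_sub hT]; omega)
    refine ⟨T ::ₘ B, by simp [hB], ?_, ?_⟩
    · rw [Multiset.sum_cons, ← hsplit, add_comm]
      exact add_le_add_left hBS _
    · simp only [Multiset.mem_cons, forall_eq_or_imp]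
      exact ⟨⟨by simpa using hT0, hTs, hTc⟩, hBT⟩

/-- If the kernel of `f` forces zero sums among the block sums, the blocks can be merged into a
zero-sum submultiset. -/
theorem exists_zeroSum_of_blocks {G : Type*} [AddCommGroup G] (f : G →+ A) {q k : ℕ}
    (hker : ForcesZeroSum f.ker k) (B : Multiset (Multiset G)) (hBk : Multiset.card B = k)
    (hB : ∀ T ∈ B, T ≠ 0 ∧ f T.sum = 0 ∧ Multiset.card T ≤ q) :
    ∃ T ≤ B.sum, T ≠ 0 ∧ T.sum = 0 ∧ Multiset.card T ≤ k * q := by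
  let σ : {T // T ∈ B} → f.ker := fun T => ⟨T.1.sum, (hB T.1 T.2).2.1⟩
  obtain ⟨C, hC, hC0, hCs⟩ := hker (B.attach.map σ) (by simp [hBk])
  obtain ⟨U, hU, rfl⟩ := Multiset.exists_le_map_eq_of_le_map hC
  have hV : U.map Subtype.val ≤ B := by
    simpa using Multiset.map_le_map (f := Subtype.val) hU
  have hVc : Multiset.card (U.map Subtype.val) ≤ k := hBk ▸ Multiset.card_le_card hV
  have hsumsum : ∀ V : Multiset (Multiset G), V.sum.sum = (V.map Multiset.sum).sum := by
    intro V
    induction V using Multiset.induction_on with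
    | empty => simp
    | cons T V ih => simp [ih]
  refine ⟨(U.map Subtype.val).sum, ?_, ?_, ?_, ?_⟩
  · obtain ⟨W, hW⟩ := Multiset.le_iff_exists_add.1 hV
    conv_rhs => rw [hW, Multiset.sum_add]
    exact Multiset.le_add_right _ _
  · intro h0
    obtain ⟨T, hT⟩ := Multiset.exists_mem_of_ne_zero (s := U) (by simpa using hC0)
    have : T.1 ≤ (U.map Subtype.val).sum :=
      Multiset.le_sum_of_mem (Multiset.mem_map_of_mem _ hT)
    rw [h0] at this
    exact (hB T.1 T.2).1 (by simpa using this)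
  · have := congrArg f.ker.subtype hCs
    rw [map_multiset_sum, Multiset.map_map, map_zero] at this
    rw [hsumsum, Multiset.map_map]
    exact this
  · change Multiset.cardHom _ ≤ _
    rw [map_multiset_sum]
    refine (Multiset.sum_le_card_nsmul _ q ?_).trans ?_
    · intro x hx
      obtain ⟨T, hT, rfl⟩ := Multiset.mem_map.1 hx
      exact (hB T (Multiset.mem_of_le hV hT)).2.2
    · rw [Multiset.card_map, smul_eq_mul]
      exact Nat.mul_le_mul_right q hVc

end ShortZeroSums

section CyclicFactors

variable {H : Type*} [AddCommGroup H]

theorem closure_range_sumElim_eq_top {k : ℕ} {κ : Type*} {a : κ → H}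
    (ha : AddSubgroup.closure (Set.range a) = ⊤) :
    AddSubgroup.closure (Set.range
      (Sum.elim (fun _ : Unit => ((1 : ZMod k), (0 : H))) fun i => (0, a i))) = ⊤ := by
  rw [eq_top_iff]
  rintro ⟨x, h⟩ -
  set K := AddSubgroup.closure (Set.range
    (Sum.elim (fun _ : Unit => ((1 : ZMod k), (0 : H))) fun i => (0, a i)))
  have h1 : ((x, 0) : ZMod k × H) ∈ K := by
    obtain ⟨z, rfl⟩ := ZMod.intCast_surjective x
    have : ((z : ZMod k), (0 : H)) = z • ((1 : ZMod k), (0 : H)) := by simp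
    rw [this]
    exact K.zsmul_mem (AddSubgroup.subset_closure ⟨Sum.inl (), rfl⟩) z
  have h2 : ((0, h) : ZMod k × H) ∈ K := by
    have hle : AddSubgroup.closure (Set.range a) ≤ K.comap (AddMonoidHom.inr (ZMod k) H) := by
      rw [AddSubgroup.closure_le]
      rintro _ ⟨i, rfl⟩
      exact AddSubgroup.subset_closure ⟨Sum.inr i, rfl⟩
    exact hle (ha ▸ AddSubgroup.mem_top h)
  simpa using K.add_mem h1 h2

theorem zeroSumFree_replicate_add_map {k : ℕ} (hk : 0 < k) {S : Multiset H}
    (hS : ZeroSumFree S) :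
    ZeroSumFree (S.map (fun h => ((0 : ZMod k), h)) +
      Multiset.replicate (k - 1) ((1 : ZMod k), (0 : H))) := by
  refine ZeroSumFree.add_replicate hk (AddMonoidHom.fst (ZMod k) H) rfl ?_ ?_
  · intro T hT h0
    obtain ⟨U, hU, rfl⟩ := Multiset.exists_le_map_eq_of_le_map hT
    have h1 := congrArg (AddMonoidHom.snd (ZMod k) H) h0
    rw [map_multiset_sum, Multiset.map_map] at h1
    have h2 : U.sum = 0 := by simpa using h1
    simp [hS U hU h2]
  · intro s hs
    obtain ⟨h, -, rfl⟩ := Multiset.mem_map.1 hs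
    rfl

/-- The reduction map `C_{mk} ⊕ H → C_k ⊕ H`. -/
def zmodProdReduction (m k : ℕ) (H : Type*) [AddCommGroup H] : ZMod (m * k) × H →+ ZMod k × H :=
  AddMonoidHom.prodMap (ZMod.castHom (dvd_mul_left k m) (ZMod k)).toAddMonoidHom
    (AddMonoidHom.id H)

theorem card_ker_zmodProdReduction {m k : ℕ} (hk : 0 < k) [Finite H] :
    Nat.card (zmodProdReduction m k H).ker = m := by
  have hsurj : Function.Surjective (zmodProdReduction m k H) := by
    rintro ⟨x, h⟩
    obtain ⟨y, rfl⟩ := ZMod.castHom_surjective (dvd_mul_left k m) x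
    exact ⟨(y, h), rfl⟩
  have h := AddSubgroup.card_mul_index (zmodProdReduction m k H).ker
  rw [AddSubgroup.index_ker, AddMonoidHom.range_eq_top.2 hsurj, AddSubgroup.card_top,
    Nat.card_prod, Nat.card_prod, Nat.card_zmod, Nat.card_zmod, ← mul_assoc] at h
  have hH : 0 < Nat.card H := Nat.card_pos
  exact Nat.eq_of_mul_eq_mul_right hk (Nat.eq_of_mul_eq_mul_right hH h)

theorem le_exponent_zmod_prod {k : ℕ} (hk : 0 < k) [Finite H] :
    k ≤ AddMonoid.exponent (ZMod k × H) := by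
  have : NeZero k := ⟨hk.ne'⟩
  refine Nat.le_of_dvd (Nat.pos_of_ne_zero AddMonoid.exponent_ne_zero_of_finite) ?_
  have h := AddMonoid.exponent_nsmul_eq_zero ((1, 0) : ZMod k × H)
  have h1 := congrArg Prod.fst h
  simpa [ZMod.natCast_eq_zero_iff] using h1

end CyclicFactors

/-- Let `m, n ≥ 1`, let `H` be a finite abelian `p`-group with
`D(H) ≤ pⁿ`, and let `G = C_{m·pⁿ} ⊕ H`. Then any zero-sum sequence over `G` of length
at least `D(G) + 1` contains a nonempty zero-sum subsequence of length at most `exp(G)`. -/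
theorem stmt14 (p : ℕ) (hp : p.Prime) (m n : ℕ) (hm : 1 ≤ m) (hn : 1 ≤ n)
    (H : Type*) [AddCommGroup H] [Finite H]
    (hpH : ∀ h : H, ∃ k : ℕ, p ^ k • h = 0)
    (hDH : davenport H ≤ p ^ n)
    (S : Multiset (ZMod (m * p ^ n) × H)) (hSsum : S.sum = 0)
    (hScard : davenport (ZMod (m * p ^ n) × H) + 1 ≤ Multiset.card S) :
    ∃ T : Multiset (ZMod (m * p ^ n) × H), T ≤ S ∧ T ≠ 0 ∧ T.sum = 0 ∧
      Multiset.card T ≤ AddMonoid.exponent (ZMod (m * p ^ n) × H) := by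
  have hq : 0 < p ^ n := pow_pos hp.pos n
  have hmq : 0 < m * p ^ n := Nat.mul_pos hm hq
  have : NeZero (m * p ^ n) := ⟨hmq.ne'⟩
  obtain ⟨ι, _, e, a, φ, hφ1, hφ0, ha, hgen⟩ := exists_generators_and_coordinates hp H hpH
  classical
  set d := ∑ i, (p ^ e i - 1) with hd
  have hfree := ZeroSumFree.sum_replicate (fun i => p ^ e i) (fun i => pow_pos hp.pos _) φ a
    hφ1 hφ0 Finset.univ
  have hdq : d < p ^ n := by
    have := lt_davenport_of_zeroSumFree hfree
    simp only [Multiset.card_sum, Multiset.card_replicate] at this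
    omega
  have hG := lt_davenport_of_zeroSumFree (zeroSumFree_replicate_add_map hmq hfree)
  simp only [Multiset.card_add, Multiset.card_map, Multiset.card_sum, Multiset.card_replicate] at hG
  have hS : m * p ^ n + (d + 1) ≤ Multiset.card S := by omega
  have hgen1 := closure_range_sumElim_eq_top (k := p ^ n) hgen
  have h1 : ForcesZeroSum (ZMod (p ^ n) × H) (p ^ n + d) := by
    have h := forcesZeroSum_of_generators hp _ (Sum.elim (fun _ => n) e)
      (by rintro (_ | i) <;> simp [ha]) hgen1
    simp only [Fintype.sum_sum_type, Sum.elim_inl, Sum.elim_inr, Finset.univ_unique,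
      Finset.sum_singleton] at h
    exact fun S hS => h S (by omega)
  have h2 : ForcesZeroSum (ZMod (p ^ n) × (ZMod (p ^ n) × H)) (3 * p ^ n - 1) := by
    have h := forcesZeroSum_of_generators hp _ (Sum.elim (fun _ => n) (Sum.elim (fun _ => n) e))
      (by rintro (_ | _ | i) <;> simp [ha]) (closure_range_sumElim_eq_top (k := p ^ n) hgen1)
    simp only [Fintype.sum_sum_type, Sum.elim_inl, Sum.elim_inr, Finset.univ_unique,
      Finset.sum_singleton] at h
    exact fun S hS => h S (by omega)
  obtain ⟨B, hBm, hBS, hB⟩ := exists_blocks (zmodProdReduction m (p ^ n) H) (c := d + 1)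
    (fun S hS hc => exists_zeroSum_card_le hdq h1 h2 hS (by omega)) m S
    (by rw [hSsum, map_zero]) hS
  have hker : ForcesZeroSum (zmodProdReduction m (p ^ n) H).ker m := by
    have h := forcesZeroSum_card (A := (zmodProdReduction m (p ^ n) H).ker)
    rwa [card_ker_zmodProdReduction hq] at h
  obtain ⟨T, hT, hT0, hTs, hTc⟩ := exists_zeroSum_of_blocks _ hker B hBm hB
  exact ⟨T, hT.trans hBS, hT0, hTs, hTc.trans (le_exponent_zmod_prod hmq)⟩
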